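/- Let B be a matrix in SO(3). There exists a complex number λ with B·Z₀·Bᵀ = λ·Z₀ if and only if there exist real numbers r, s with r² + s² = 1 such that B is the matrix with rows (1,0,0), (0,r,−s), (0,s,r); and in that case λ = r − i·s. (Consequently, the isotropy group of the point [Z₀] under the action of SO(3) induced by the Cartan representation is isomorphic to SO(2).) -/

import Mathlib

open Matrix

/-- The point `Z₀ = (1/2)·[[0,1,i],[1,0,0],[i,0,0]]` of the complex quadric. -/
noncomputable def Z₀ : Matrix (Fin 3) (Fin 3) ℂ :=
  (1/2 : ℂ) • !![0, 1, Complex.I; 1, 0, 0; Complex.I, 0, 0]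

/-- A rotation about the first axis multiplies `Z₀` by `r - i s`. -/
theorem rotation_conj_Z₀ (r s : ℝ) :
    (!![1, 0, 0; 0, r, -s; 0, s, r] : Matrix (Fin 3) (Fin 3) ℝ).map Complex.ofReal * Z₀ *
      ((!![1, 0, 0; 0, r, -s; 0, s, r] : Matrix (Fin 3) (Fin 3) ℝ).map Complex.ofReal)ᵀ =
        ((r : ℂ) - Complex.I * (s : ℂ)) • Z₀ := by
  ext i j
  fin_cases i <;> fin_cases j <;>
    simp [Z₀, Matrix.mul_apply, Fin.sum_univ_three, Complex.ext_iff] <;> ring_nf <;> trivial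

/-- The entries of `B * Z₀ * Bᵀ`. -/
theorem conj_Z₀_apply (B : Matrix (Fin 3) (Fin 3) ℝ) (i j : Fin 3) :
    (B.map Complex.ofReal * Z₀ * (B.map Complex.ofReal)ᵀ) i j =
      (1 / 2 : ℂ) * (B i 0 * (B j 1 + B j 2 * Complex.I) +
        (B i 1 + B i 2 * Complex.I) * B j 0) := by
  simp [Z₀, Matrix.mul_apply, Fin.sum_univ_three]
  ring

/-- A matrix in `SO(3)` fixing the line spanned by `Z₀` is a rotation about the first axis. -/
theorem eq_rotation_of_conj_Z₀ {B : Matrix (Fin 3) (Fin 3) ℝ} (hB : B * Bᵀ = 1)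
    (hdet : B.det = 1) {lam : ℂ}
    (h : B.map Complex.ofReal * Z₀ * (B.map Complex.ofReal)ᵀ = lam • Z₀) :
    ∃ r s : ℝ, r ^ 2 + s ^ 2 = 1 ∧ B = !![1, 0, 0; 0, r, -s; 0, s, r] := by
  have entry (i j : Fin 3) := (conj_Z₀_apply B i j).symm.trans (congrFun (congrFun h i) j)
  have h00 := entry 0 0
  have h11 := entry 1 1
  have h22 := entry 2 2
  have h12 := entry 1 2
  have h01 := entry 0 1
  have h02 := entry 0 2
  have o11 := congrFun (congrFun hB 1) 1
  simp [Z₀, Complex.ext_iff] at h00 h11 h22 h12 h01 h02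
  simp [Matrix.mul_apply, Fin.sum_univ_three] at o11
  rw [Matrix.det_fin_three] at hdet
  have a1 : B 1 0 = 0 := by
    by_contra ha
    have b1 : B 1 1 = 0 := mul_left_cancel₀ ha (by linarith [h11.1])
    have c1 : B 1 2 = 0 := mul_left_cancel₀ ha (by linarith [h11.2])
    rw [b1, c1] at h12 hdet
    have b2 : B 2 1 = 0 := mul_left_cancel₀ ha (by linarith [h12.1])
    have c2 : B 2 2 = 0 := mul_left_cancel₀ ha (by linarith [h12.2])
    simp [b2, c2] at hdet
  have a2 : B 2 0 = 0 := by
    by_contra ha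
    have b2 : B 2 1 = 0 := mul_left_cancel₀ ha (by linarith [h22.1])
    have c2 : B 2 2 = 0 := mul_left_cancel₀ ha (by linarith [h22.2])
    rw [b2, c2] at h12 hdet
    have b1 : B 1 1 = 0 := mul_left_cancel₀ ha (by linarith [h12.1])
    have c1 : B 1 2 = 0 := mul_left_cancel₀ ha (by linarith [h12.2])
    simp [b1, c1] at hdet
  rw [a1, a2] at hdet
  rw [a1] at h01
  rw [a2] at h02
  have ha0 : B 0 0 ≠ 0 := by
    intro ha
    simp [ha] at hdet
  have b0 : B 0 1 = 0 := mul_left_cancel₀ ha0 (by linarith [h00.1])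
  have c0 : B 0 2 = 0 := mul_left_cancel₀ ha0 (by linarith [h00.2])
  have hb2 : B 2 1 = -B 1 2 := mul_left_cancel₀ ha0 (by linarith [h01.2, h02.1])
  have hc2 : B 2 2 = B 1 1 := mul_left_cancel₀ ha0 (by linarith [h01.1, h02.2])
  have hrs : B 1 1 ^ 2 + B 1 2 ^ 2 = 1 := by
    rw [a1] at o11
    linarith
  have ha : B 0 0 = 1 := by
    rw [b0, c0, hb2, hc2] at hdet
    linear_combination hdet - B 0 0 * hrs
  refine ⟨B 1 1, -B 1 2, by linarith, ?_⟩
  ext i j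
  fin_cases i <;> fin_cases j <;> simp [*]

/-- For `B ∈ SO(3)`, `B·Z₀·Bᵀ` is a complex multiple of `Z₀` if and only if `B` is a rotation
about the first axis, i.e. `B = [[1,0,0],[0,r,−s],[0,s,r]]` with `r² + s² = 1`; and in that case
the multiplier is `λ = r − i·s`.  (Hence the isotropy group of `[Z₀]` is isomorphic to SO(2).) -/
theorem isotropy_SO3_at_Z₀
    (B : Matrix (Fin 3) (Fin 3) ℝ) (hB : B * Bᵀ = 1) (hdet : B.det = 1) :
    ((∃ lam : ℂ, B.map (Complex.ofReal) * Z₀ * (B.map (Complex.ofReal))ᵀ = lam • Z₀) ↔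
      (∃ r s : ℝ, r ^ 2 + s ^ 2 = 1 ∧ B = !![1, 0, 0; 0, r, -s; 0, s, r])) ∧
    (∀ r s : ℝ, r ^ 2 + s ^ 2 = 1 → B = !![1, 0, 0; 0, r, -s; 0, s, r] →
      B.map (Complex.ofReal) * Z₀ * (B.map (Complex.ofReal))ᵀ =
        ((r : ℂ) - Complex.I * (s : ℂ)) • Z₀) := by
  refine ⟨⟨fun ⟨_, h⟩ => eq_rotation_of_conj_Z₀ hB hdet h, ?_⟩, ?_⟩
  · rintro ⟨r, s, -, rfl⟩
    exact ⟨_, rotation_conj_Z₀ r s⟩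
  · rintro r s - rfl
    exact rotation_conj_Z₀ r s
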